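/- (Uniqueness of the controller equilibrium.) Let n, m be positive integers; let α, β, γ > 0; let R_s, I_l, Π_c, Π_u ∈ ℝ^{n×n} be diagonal with strictly positive diagonal entries; let R ∈ ℝ^{m×m} be diagonal with strictly positive diagonal entries, B ∈ ℝ^{n×m}, 𝓛 := B R⁻¹ Bᵀ, and V_d ∈ ℝⁿ. Fix constant inputs ν̄_s, ν̄_l ∈ ℝⁿ. Then the system of equations β ū_s + λ̄_a − ν̄_s = 0; −α I_l Π_u⁻¹ I_l (𝟙 − ū_l) − I_l λ̄_b − ν̄_l = 0; α Π_c⁻¹ Ī_s − R_s λ̄_a + λ̄_b = 0; γ(V̄ − V_d) − λ̄_a − 𝓛 λ̄_b = 0; ū_s − R_s Ī_s − V̄ = 0; −I_l ū_l + Ī_s − 𝓛 V̄ = 0 has at most one solution (ū_s, ū_l, Ī_s, V̄, λ̄_a, λ̄_b) ∈ (ℝⁿ)⁶. -/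

import Mathlib

open Matrix

theorem inv_diagonal_of_pos {ι : Type*} [Fintype ι] [DecidableEq ι] {d : ι → ℝ}
    (hd : ∀ i, 0 < d i) : (diagonal d)⁻¹ = diagonal fun i => (d i)⁻¹ := by
  refine inv_eq_right_inv ?_
  rw [diagonal_mul_diagonal, ← diagonal_one]
  exact congrArg diagonal (funext fun i => mul_inv_cancel₀ (hd i).ne')

/-- The homogeneous saddle-point system has only the trivial solution. -/
theorem saddle_point_eq_zero {ι : Type*} [Fintype ι] {L : Matrix ι ι ℝ} (hL : L.IsSymm)
    {β γ : ℝ} (hβ : 0 < β) (hγ : 0 < γ) {s l p q : ι → ℝ}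
    (hp : ∀ i, 0 < p i) (hq : ∀ i, 0 < q i)
    {x y z v a b : ι → ℝ}
    (hx : ∀ i, β * x i + a i = 0) (hy : ∀ i, p i * y i - l i * b i = 0)
    (hz : ∀ i, q i * z i - s i * a i + b i = 0)
    (hv : ∀ i, γ * v i - a i - (L *ᵥ b) i = 0)
    (ha : ∀ i, x i - s i * z i - v i = 0) (hb : ∀ i, -(l i * y i) + z i - (L *ᵥ v) i = 0)
    (i : ι) : x i = 0 ∧ y i = 0 ∧ z i = 0 ∧ v i = 0 ∧ a i = 0 ∧ b i = 0 := by
  have hsym : ∑ j, v j * (L *ᵥ b) j = ∑ j, b j * (L *ᵥ v) j := by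
    change v ⬝ᵥ L *ᵥ b = b ⬝ᵥ L *ᵥ v
    rw [dotProduct_mulVec, ← mulVec_transpose, hL.eq, dotProduct_comm]
  have hsum : ∑ j, (β * x j ^ 2 + p j * y j ^ 2 + q j * z j ^ 2 + γ * v j ^ 2) = 0 := by
    rw [← sub_eq_zero.mpr hsym, ← Finset.sum_sub_distrib]
    refine Finset.sum_congr rfl fun j _ => ?_
    linear_combination x j * hx j + y j * hy j + z j * hz j + v j * hv j - a j * ha j - b j * hb j
  have hnn : ∀ j, 0 ≤ β * x j ^ 2 + p j * y j ^ 2 + q j * z j ^ 2 + γ * v j ^ 2 := fun j => by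
    have := hp j
    have := hq j
    positivity
  have hi := (Finset.sum_eq_zero_iff_of_nonneg fun j _ => hnn j).mp hsum i (Finset.mem_univ i)
  have h1 := mul_nonneg hβ.le (sq_nonneg (x i))
  have h2 := mul_nonneg (hp i).le (sq_nonneg (y i))
  have h3 := mul_nonneg (hq i).le (sq_nonneg (z i))
  have h4 := mul_nonneg hγ.le (sq_nonneg (v i))
  have hx0 : x i = 0 := by
    have h : β * x i ^ 2 = 0 := by linarith
    simpa [hβ.ne'] using h
  have hy0 : y i = 0 := by
    have h : p i * y i ^ 2 = 0 := by linarith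
    simpa [(hp i).ne'] using h
  have hz0 : z i = 0 := by
    have h : q i * z i ^ 2 = 0 := by linarith
    simpa [(hq i).ne'] using h
  have hv0 : v i = 0 := by
    have h : γ * v i ^ 2 = 0 := by linarith
    simpa [hγ.ne'] using h
  have ha0 : a i = 0 := by simpa [hx0] using hx i
  have hb0 : b i = 0 := by simpa [hz0, ha0] using hz i
  exact ⟨hx0, hy0, hz0, hv0, ha0, hb0⟩

/-- Uniqueness of the controller equilibrium: for a fixed constant input `(ν̄_s, ν̄_l)`,
the equilibrium equations of the primal-dual controller have at most one solution. -/
theorem stmt_14 (n m : ℕ) (hn : 0 < n) (hm : 0 < m)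
    (α β γ : ℝ) (hα : 0 < α) (hβ : 0 < β) (hγ : 0 < γ)
    (rs il pc pu : Fin n → ℝ)
    (hrs : ∀ i, 0 < rs i) (hil : ∀ i, 0 < il i) (hpc : ∀ i, 0 < pc i) (hpu : ∀ i, 0 < pu i)
    (r : Fin m → ℝ) (hr : ∀ k, 0 < r k)
    (B : Matrix (Fin n) (Fin m) ℝ)
    (Vd : Fin n → ℝ)
    (Rs Il Pc Pu 𝓛 : Matrix (Fin n) (Fin n) ℝ)
    (hRs : Rs = Matrix.diagonal rs) (hIl : Il = Matrix.diagonal il)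
    (hPc : Pc = Matrix.diagonal pc) (hPu : Pu = Matrix.diagonal pu)
    (h𝓛 : 𝓛 = B * (Matrix.diagonal r)⁻¹ * Bᵀ)
    (nus nul : Fin n → ℝ) :
    ∀ us ul Is V la lb us' ul' Is' V' la' lb' : Fin n → ℝ,
      -- first solution
      (β • us + la - nus = 0) →
      (-(α • (Il * Pu⁻¹ * Il).mulVec (1 - ul)) - Il.mulVec lb - nul = 0) →
      (α • Pc⁻¹.mulVec Is - Rs.mulVec la + lb = 0) →
      (γ • (V - Vd) - la - 𝓛.mulVec lb = 0) →
      (us - Rs.mulVec Is - V = 0) →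
      (-(Il.mulVec ul) + Is - 𝓛.mulVec V = 0) →
      -- second solution
      (β • us' + la' - nus = 0) →
      (-(α • (Il * Pu⁻¹ * Il).mulVec (1 - ul')) - Il.mulVec lb' - nul = 0) →
      (α • Pc⁻¹.mulVec Is' - Rs.mulVec la' + lb' = 0) →
      (γ • (V' - Vd) - la' - 𝓛.mulVec lb' = 0) →
      (us' - Rs.mulVec Is' - V' = 0) →
      (-(Il.mulVec ul') + Is' - 𝓛.mulVec V' = 0) →
      us = us' ∧ ul = ul' ∧ Is = Is' ∧ V = V' ∧ la = la' ∧ lb = lb' := by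
  intro us ul Is V la lb us' ul' Is' V' la' lb' h1 h2 h3 h4 h5 h6 k1 k2 k3 k4 k5 k6
  have hsymm : 𝓛.IsSymm := by
    rw [h𝓛, inv_diagonal_of_pos hr]
    simp [IsSymm, transpose_mul, Matrix.mul_assoc]
  subst hRs hIl hPc hPu
  rw [inv_diagonal_of_pos hpu, diagonal_mul_diagonal, diagonal_mul_diagonal] at h2 k2
  rw [inv_diagonal_of_pos hpc] at h3 k3
  have key := saddle_point_eq_zero hsymm hβ hγ (s := rs) (l := il)
    (p := fun i => α * (il i * (pu i)⁻¹ * il i)) (q := fun i => α * (pc i)⁻¹)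
    (x := us - us') (y := ul - ul') (z := Is - Is') (v := V - V') (a := la - la') (b := lb - lb')
    (fun i => mul_pos hα (mul_pos (mul_pos (hil i) (inv_pos.mpr (hpu i))) (hil i)))
    (fun i => mul_pos hα (inv_pos.mpr (hpc i)))
    (fun i => by
      have h := congrFun h1 i
      have k := congrFun k1 i
      simp only [Pi.add_apply, Pi.sub_apply, Pi.smul_apply, Pi.zero_apply, smul_eq_mul] at h k ⊢
      linear_combination h - k)
    (fun i => by
      have h := congrFun h2 i
      have k := congrFun k2 i
      simp only [Pi.sub_apply, Pi.neg_apply, Pi.smul_apply, Pi.zero_apply, Pi.one_apply,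
        smul_eq_mul, mulVec_diagonal] at h k ⊢
      linear_combination h - k)
    (fun i => by
      have h := congrFun h3 i
      have k := congrFun k3 i
      simp only [Pi.add_apply, Pi.sub_apply, Pi.smul_apply, Pi.zero_apply, smul_eq_mul,
        mulVec_diagonal] at h k ⊢
      linear_combination h - k)
    (fun i => by
      have h := congrFun h4 i
      have k := congrFun k4 i
      simp only [Pi.sub_apply, Pi.smul_apply, Pi.zero_apply, smul_eq_mul, mulVec_sub] at h k ⊢
      linear_combination h - k)
    (fun i => by
      have h := congrFun h5 i
      have k := congrFun k5 i
      simp only [Pi.sub_apply, Pi.zero_apply, mulVec_diagonal] at h k ⊢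
      linear_combination h - k)
    (fun i => by
      have h := congrFun h6 i
      have k := congrFun k6 i
      simp only [Pi.add_apply, Pi.sub_apply, Pi.neg_apply, Pi.zero_apply, mulVec_diagonal,
        mulVec_sub] at h k ⊢
      linear_combination h - k)
  simp only [Pi.sub_apply, sub_eq_zero] at key
  exact ⟨funext fun i => (key i).1, funext fun i => (key i).2.1, funext fun i => (key i).2.2.1,
    funext fun i => (key i).2.2.2.1, funext fun i => (key i).2.2.2.2.1,
    funext fun i => (key i).2.2.2.2.2⟩
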